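/- For every t ∈ [0,∞), the preimage under φ of the σ-algebra F̌_t ∨ σ(τ̂∤t) on Ω×[0,∞] equals F_t ∨ σ(τ∤t) on Ω, i.e. φ⁻¹(F̌_t ∨ σ(τ̂∤t)) = F_t ∨ σ(τ∤t); moreover φ⁻¹(⋂_{s>t}(F̌_s ∨ σ(τ̂∤s))) = ⋂_{s>t}(F_s ∨ σ(τ∤s)). Here σ(f) denotes the σ-algebra generated by a map f into [0,∞] (the preimage of the Borel σ-algebra), and for a σ-algebra 𝒮, φ⁻¹(𝒮) = {φ⁻¹(C) : C ∈ 𝒮}. -/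

import Mathlib

open MeasureTheory
open scoped ENNReal

/-- The operation `a ∤ b`: equals `a` if `a ≤ b` and `∞` otherwise. -/
noncomputable def nmid (a b : ℝ≥0∞) : ℝ≥0∞ := if a ≤ b then a else ∞

/-- Pulling back σ-algebras commutes with decreasing countable intersections. -/
theorem comap_iInf_of_antitone {α β : Type*} (f : α → β) {m : ℕ → MeasurableSpace β}
    (hm : Antitone m) :
    MeasurableSpace.comap f (⨅ n, m n) = ⨅ n, MeasurableSpace.comap f (m n) := by
  apply le_antisymm
  · exact le_iInf fun n => MeasurableSpace.comap_mono (iInf_le m n)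
  intro A hA
  rw [MeasurableSpace.measurableSet_iInf] at hA
  choose C hC hCA using hA
  refine ⟨Filter.limsup C Filter.atTop, ?_, ?_⟩
  · rw [MeasurableSpace.measurableSet_iInf]
    intro n
    rw [← Filter.limsup_nat_add C n]
    exact @MeasurableSet.measurableSet_limsup _ (m n) _
      fun k => hm (Nat.le_add_left n k) _ (hC (k + n))
  · ext x
    have hx : ∀ n, x ∈ A ↔ f x ∈ C n := fun n => by rw [← hCA n, Set.mem_preimage]
    simp [Filter.mem_limsup_iff_frequently_mem, ← hx]

/-- An infimum of a monotone family over `(t, ∞]` is attained along a sequence. -/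
theorem iInf_gt_eq_iInf_seq {L : Type*} [CompleteLattice L] {G : ℝ≥0∞ → L} (hG : Monotone G)
    {t : ℝ≥0∞} {u : ℕ → ℝ≥0∞} (htu : ∀ n, t < u n)
    (hu : Filter.Tendsto u Filter.atTop (nhds t)) :
    ⨅ (s : ℝ≥0∞) (_ : t < s), G s = ⨅ n, G (u n) := by
  apply le_antisymm
  · exact le_iInf fun n => iInf₂_le (u n) (htu n)
  · refine le_iInf₂ fun s hs => ?_
    obtain ⟨n, hn⟩ := (hu.eventually_lt_const hs).exists
    exact (iInf_le _ n).trans (hG hn.le)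

/-- Pulling back σ-algebras commutes with the right limits of an increasing family. -/
theorem comap_iInf_gt_of_monotone {α β : Type*} (f : α → β) {G : ℝ≥0∞ → MeasurableSpace β}
    (hG : Monotone G) {t : ℝ≥0∞} (ht : t ≠ ∞) :
    MeasurableSpace.comap f (⨅ (s : ℝ≥0∞) (_ : t < s), G s)
      = ⨅ (s : ℝ≥0∞) (_ : t < s), MeasurableSpace.comap f (G s) := by
  obtain ⟨u, hu_anti, hu_mem, hu_lim⟩ := exists_seq_strictAnti_tendsto' ht.lt_top
  rw [iInf_gt_eq_iInf_seq hG (fun n => (hu_mem n).1) hu_lim,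
    iInf_gt_eq_iInf_seq (G := fun s => MeasurableSpace.comap f (G s))
      (fun _ _ h => MeasurableSpace.comap_mono (hG h)) (fun n => (hu_mem n).1) hu_lim]
  exact comap_iInf_of_antitone f (hG.comp_antitone hu_anti.antitone)

theorem measurable_nmid_left (b : ℝ≥0∞) : Measurable fun a => nmid a b :=
  Measurable.ite measurableSet_Iic measurable_id measurable_const

theorem nmid_nmid_of_le {b c : ℝ≥0∞} (h : b ≤ c) (a : ℝ≥0∞) :
    nmid (nmid a c) b = nmid a b := by
  unfold nmid
  by_cases hac : a ≤ c
  · rw [if_pos hac]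
  · have hab : ¬ a ≤ b := fun hab => hac (hab.trans h)
    simp [hac, hab]

theorem monotone_comap_nmid {α : Type*} (f : α → ℝ≥0∞) :
    Monotone fun s => MeasurableSpace.comap (fun x => nmid (f x) s) inferInstance := by
  intro b c h
  have hcomp : (fun x => nmid (f x) b) = (fun a => nmid a b) ∘ fun x => nmid (f x) c :=
    funext fun x => (nmid_nmid_of_le h (f x)).symm
  dsimp only
  rw [hcomp, ← MeasurableSpace.comap_comp]
  exact MeasurableSpace.comap_mono (measurable_nmid_left b).comap_le

/-- With `φ ω = (ω, τ ω)`, `π = Prod.fst`, `τ̂ (ω,u) = u` and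
`F̌ t = π⁻¹ (F t)` on the product space `Ω × [0,∞]`, for every `t ∈ [0,∞)` the preimage
under `φ` of `F̌ t ∨ σ(τ̂ ∤ t)` equals `F t ∨ σ(τ ∤ t)`, and the preimage under `φ` of
`⋂_{s > t} (F̌ s ∨ σ(τ̂ ∤ s))` equals `⋂_{s > t} (F s ∨ σ(τ ∤ s))`.  Preimages of
σ-algebras are `comap`s, `σ(f)` is the `comap` of the Borel σ-algebra along `f`, and
intersections of σ-algebras are infima. -/
theorem comap_phi_progressive_enlargement
    {Ω : Type*} [𝒜 : MeasurableSpace Ω]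
    (F : ℝ≥0∞ → MeasurableSpace Ω) (hF_le : ∀ t, F t ≤ 𝒜) (hF_mono : Monotone F)
    (hF_rc : ∀ t : ℝ≥0∞, t ≠ ∞ → F t = ⨅ (s : ℝ≥0∞) (_ : t < s), F s)
    (τ : Ω → ℝ≥0∞) (hτ : Measurable τ)
    (φ : Ω → Ω × ℝ≥0∞) (hφ : φ = fun ω => (ω, τ ω))
    (t : ℝ≥0∞) (ht : t ≠ ∞) :
    MeasurableSpace.comap φ
        ((F t).comap Prod.fst ⊔
          MeasurableSpace.comap (fun p : Ω × ℝ≥0∞ => nmid p.2 t) inferInstance)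
      = F t ⊔ MeasurableSpace.comap (fun ω => nmid (τ ω) t) inferInstance
    ∧ MeasurableSpace.comap φ
        (⨅ (s : ℝ≥0∞) (_ : t < s),
          ((F s).comap Prod.fst ⊔
            MeasurableSpace.comap (fun p : Ω × ℝ≥0∞ => nmid p.2 s) inferInstance))
      = ⨅ (s : ℝ≥0∞) (_ : t < s),
          (F s ⊔ MeasurableSpace.comap (fun ω => nmid (τ ω) s) inferInstance) := by
  have key (s : ℝ≥0∞) : MeasurableSpace.comap φ
      ((F s).comap Prod.fst ⊔
        MeasurableSpace.comap (fun p : Ω × ℝ≥0∞ => nmid p.2 s) inferInstance)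
      = F s ⊔ MeasurableSpace.comap (fun ω => nmid (τ ω) s) inferInstance := by
    subst hφ
    rw [MeasurableSpace.comap_sup, MeasurableSpace.comap_comp, MeasurableSpace.comap_comp]
    exact congrArg (· ⊔ _) MeasurableSpace.comap_id
  refine ⟨key t, ?_⟩
  rw [comap_iInf_gt_of_monotone φ (G := fun s => (F s).comap Prod.fst ⊔
    MeasurableSpace.comap (fun p : Ω × ℝ≥0∞ => nmid p.2 s) inferInstance) _ ht]
  · exact iInf_congr fun s => iInf_congr fun _ => key s
  · exact fun _ _ h => sup_le_sup (MeasurableSpace.comap_mono (hF_mono h))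
      (monotone_comap_nmid Prod.snd h)
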